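/- arXiv:2105.04074 — 3 statements merged into one kernel-verified Lean document; each statement's English description precedes it below -/
import Mathlib

section
/- Let n ≥ 3 be an integer. For every d = (d₁,d₂) ∈ ℤ² with d₂ ≤ 0 and n·d₁ − d₂ ≤ 0, the ideal Σ_{m ∈ JMon_n} I(Ω(d − m)) of ℂ[θ₁,θ₂] is a proper subset of the vanishing ideal of {a ∈ S_n : a + d ∉ JMon_n}. (This expresses that JD(R_{A_n}) ≠ D(R_{A_n}, J) for the rational normal curve of degree n ≥ 3, in all multidegrees of the third chamber including 0 and the negatives of the two facets.) -/
open MvPolynomial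

noncomputable section

/-- The polynomial ring ℂ[θ₁, θ₂]. -/
abbrev Cθ : Type := MvPolynomial (Fin 2) ℂ

/-- The vanishing ideal of a set `V ⊆ ℤ²` inside ℂ[θ₁, θ₂]. -/
def vanishingIdeal (V : Set (ℤ × ℤ)) : Ideal Cθ where
  carrier := {f | ∀ a ∈ V, eval ![(a.1 : ℂ), (a.2 : ℂ)] f = 0}
  add_mem' := by
    intro f g hf hg a ha
    simp [map_add, hf a ha, hg a ha]
  zero_mem' := by
    intro a _
    simp
  smul_mem' := by
    intro c f hf a ha
    simp [smul_eq_mul, hf a ha]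

/-- The descending factorial `(P, m)! = ∏_{j=0}^{m} (P - j)`, equal to `1` when `m < 0`. -/
def dfact (P : Cθ) (m : ℤ) : Cθ :=
  ∏ j ∈ Finset.range (m + 1).toNat, (P - C (j : ℂ))

/-- The saturated affine semigroup `S_n = {(x, y) ∈ ℤ² : 0 ≤ y ≤ n x}` of the rational
normal curve of degree `n`. -/
def Sset (n : ℤ) : Set (ℤ × ℤ) := {a | 0 ≤ a.2 ∧ a.2 ≤ n * a.1}

/-- `Ω(d) = {a ∈ S_n : a + d ∉ S_n}`. -/
def Omega (n : ℤ) (d : ℤ × ℤ) : Set (ℤ × ℤ) := {a | a ∈ Sset n ∧ a + d ∉ Sset n}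

/-- `JMon_n = {a ∈ S_n : h₁(a) > 0 and h₂(a) > 0}`, the exponents of the monomials of the
radical interior ideal `J = ⟨st, …, stⁿ⁻¹⟩`. -/
def JMon (n : ℤ) : Set (ℤ × ℤ) := {a | a ∈ Sset n ∧ 0 < a.2 ∧ 0 < n * a.1 - a.2}

/-- The vanishing ideal is antitone in the set of points. -/
theorem vanishingIdeal_anti {V W : Set (ℤ × ℤ)} (h : V ⊆ W) :
    vanishingIdeal W ≤ vanishingIdeal V :=
  fun _ hf a ha => hf a (h ha)

/-- A polynomial vanishing at all far enough integral points of the line `θ₂ = α θ₁ + β` vanishes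
on the whole line. -/
theorem eval_line_eq_zero (f : Cθ) (α β N : ℤ)
    (h : ∀ x : ℤ, N ≤ x → eval ![(x : ℂ), ((α * x + β : ℤ) : ℂ)] f = 0) (z : ℂ) :
    eval ![z, α * z + β] f = 0 := by
  set g : Polynomial ℂ :=
    aeval ![Polynomial.X, Polynomial.C (α : ℂ) * Polynomial.X + Polynomial.C (β : ℂ)] f with hg
  have key : ∀ w : ℂ, g.eval w = eval ![w, α * w + β] f := by
    intro w
    rw [hg, ← Polynomial.coe_aeval_eq_eval, ← coe_aeval_eq_eval, RingHom.coe_coe,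
      ← AlgHom.comp_apply, comp_aeval]
    congr 2
    funext i
    fin_cases i <;> simp
  have g_zero : g = 0 := by
    refine Polynomial.eq_zero_of_infinite_isRoot g (Set.Infinite.mono ?_
      ((Set.Ici_infinite N).image (Int.cast_injective (α := ℂ)).injOn))
    rintro _ ⟨x, hx, rfl⟩
    have := h x hx
    push_cast at this
    rw [Set.mem_ofPred_eq, Polynomial.IsRoot.def, key, this]
  rw [← key, g_zero, Polynomial.eval_zero]

/-- The value of a descending factorial at a point where `P` takes an integral value `k`
vanishes exactly when `0 ≤ k ≤ m`. -/
theorem eval_dfact_eq_zero_iff {v : Fin 2 → ℂ} {P : Cθ} {k : ℤ} (hP : eval v P = k) (m : ℤ) :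
    eval v (dfact P m) = 0 ↔ 0 ≤ k ∧ k ≤ m := by
  simp only [dfact, map_prod, Finset.prod_eq_zero_iff, Finset.mem_range, map_sub, eval_C, hP,
    sub_eq_zero]
  constructor
  · rintro ⟨j, hj, h⟩
    have : k = j := by exact_mod_cast h
    omega
  · rintro ⟨h0, hk⟩
    refine ⟨k.toNat, by omega, ?_⟩
    have : k = k.toNat := by omega
    exact_mod_cast this

/-- For `n ≥ 3` and `m` in the interior of the semigroup, every polynomial vanishing on `Ω(d - m)`
vanishes at the (non-lattice) point where the facet functionals take the values `1 - h₁(d)` and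
`1 - h₂(d)`. -/
theorem eval_eq_zero_of_mem_vanishingIdeal_Omega {n : ℤ} (hn : 3 ≤ n) {d m : ℤ × ℤ}
    (h1 : d.2 ≤ 0) (h2 : n * d.1 - d.2 ≤ 0) (hm : m ∈ JMon n) {f : Cθ}
    (hf : f ∈ vanishingIdeal (Omega n (d - m))) {z : ℂ} (hz : n * z = 2 - n * d.1) :
    eval ![z, 1 - d.2] f = 0 := by
  obtain ⟨-, hm1, hm2⟩ := hm
  rcases le_or_gt 2 m.2 with h | h
  · have := eval_line_eq_zero f 0 (1 - d.2) (1 - d.2) (fun x hx => hf (x, 0 * x + (1 - d.2)) ?_) z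
    · simpa using this
    · simp only [Omega, Sset, Set.mem_ofPred_eq, Prod.fst_add, Prod.snd_add, Prod.fst_sub,
        Prod.snd_sub]
      refine ⟨⟨by omega, by nlinarith⟩, fun h' => by omega⟩
  · have hm3 : 2 ≤ n * m.1 - m.2 := by
      have : 0 < m.1 := by
        by_contra! h0
        nlinarith
      nlinarith
    have := eval_line_eq_zero f n (n * d.1 - d.2 - 1) (1 - (n * d.1 - d.2))
      (fun x hx => hf (x, n * x + (n * d.1 - d.2 - 1)) ?_) z
    · have hv : (1 : ℂ) - d.2 = n * z + ((n * d.1 - d.2 - 1 : ℤ) : ℂ) := by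
        rw [hz]
        push_cast
        ring
      rw [hv, this]
    · simp only [Omega, Sset, Set.mem_ofPred_eq, Prod.fst_add, Prod.snd_add, Prod.fst_sub,
        Prod.snd_sub]
      refine ⟨⟨by nlinarith, by omega⟩, fun h' => by nlinarith [h'.2]⟩

/-- For the rational normal curve of degree `n ≥ 3` and any multidegree `d` in the closed
third chamber (`h₁(d) ≤ 0` and `h₂(d) ≤ 0`), the sum `Σ_{m ∈ JMon_n} I(Ω(d − m))` is a
proper subset of the vanishing ideal of `{a ∈ S_n : a + d ∉ JMon_n}`; that is,
`J D(R_{A_n}) ≠ D(R_{A_n}, J)` in these multidegrees. -/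
theorem statement6 (n : ℤ) (hn : 3 ≤ n) (d : ℤ × ℤ)
    (h1 : d.2 ≤ 0) (h2 : n * d.1 - d.2 ≤ 0) :
    (⨆ m ∈ JMon n, vanishingIdeal (Omega n (d - m))) <
      vanishingIdeal {a | a ∈ Sset n ∧ a + d ∉ JMon n} := by
  set F : Cθ := dfact (X 1) (-d.2) * dfact (C (n : ℂ) * X 0 - X 1) (-(n * d.1 - d.2)) with hF
  have hn0 : (n : ℂ) ≠ 0 := by
    have : n ≠ 0 := by omega
    exact_mod_cast this
  set z : ℂ := (2 - n * d.1) / n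
  have hz : n * z = 2 - n * d.1 := mul_div_cancel₀ _ hn0
  refine lt_of_le_of_ne (iSup₂_le fun m hm => vanishingIdeal_anti ?_) fun h => ?_
  · rintro a ⟨ha, had⟩
    refine ⟨ha, fun h' => had ?_⟩
    obtain ⟨-, hm1, hm2⟩ := hm
    simp only [JMon, Sset, Set.mem_ofPred_eq, Prod.fst_add, Prod.snd_add, Prod.fst_sub,
      Prod.snd_sub] at h' ⊢
    refine ⟨⟨by omega, by nlinarith⟩, by omega, by nlinarith⟩
  · have hF_mem : F ∈ vanishingIdeal {a | a ∈ Sset n ∧ a + d ∉ JMon n} := by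
      rintro a ⟨⟨ha1, ha2⟩, had⟩
      rw [hF, map_mul, mul_eq_zero,
        eval_dfact_eq_zero_iff (k := a.2) (by simp),
        eval_dfact_eq_zero_iff (k := n * a.1 - a.2) (by simp)]
      by_contra! hcon
      have := hcon.1 ha1
      have := hcon.2 (by omega)
      refine had ⟨⟨?_, ?_⟩, ?_, ?_⟩ <;> simp only [Prod.fst_add, Prod.snd_add] <;> nlinarith
    have hle : (⨆ m ∈ JMon n, vanishingIdeal (Omega n (d - m))) ≤
        RingHom.ker (eval ![z, 1 - (d.2 : ℂ)]) :=
      iSup₂_le fun m hm f hf => eval_eq_zero_of_mem_vanishingIdeal_Omega hn h1 h2 hm hf hz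
    have hF_zero : eval ![z, 1 - (d.2 : ℂ)] F = 0 := hle (h ▸ hF_mem)
    rw [hF, map_mul, mul_eq_zero,
      eval_dfact_eq_zero_iff (k := 1 - d.2) (by simp),
      eval_dfact_eq_zero_iff (k := 1 - (n * d.1 - d.2)) (by simp [hz]; ring)] at hF_zero
    omega

end
end

section
/- Let n = 3. For every d = (d₁,d₂) ∈ ℤ² with d₂ ≤ 0 and 3d₁ − d₂ ≤ 0, the ideal Σ_{m ∈ JMon₃} I(Ω(d − m)) of ℂ[θ₁,θ₂] equals the ideal generated by the two polynomials (H₁, −d₂)! · (H₂, −3d₁+d₂+1)! and (H₁, −d₂+1)! · (H₂, −3d₁+d₂)!. (This computes the multigraded pieces of JD(R_{A₃}) on the third chamber together with the negatives of the two facets.) -/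
open MvPolynomial

noncomputable section

/-- The quotient by `X 1 - c(X 0)` is detected by substituting `c` for the second variable. -/
theorem X_one_sub_dvd_iff (c : Polynomial ℂ) (f : Cθ) :
    X 1 - Polynomial.aeval (X 0) c ∣ f ↔ aeval ![Polynomial.X, c] f = 0 := by
  constructor
  · rintro ⟨g, rfl⟩
    have h : aeval ![Polynomial.X, c] (Polynomial.aeval (X 0 : Cθ) c) = c := by
      rw [← Polynomial.aeval_algHom_apply]
      simp
    simp [h]
  · intro h
    rw [← Ideal.mem_span_singleton, ← Ideal.Quotient.eq_zero_iff_mem]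
    let π := Ideal.Quotient.mkₐ ℂ (Ideal.span {(X 1 - Polynomial.aeval (X 0) c : Cθ)})
    have hπ : π = (π.comp (Polynomial.aeval (X 0 : Cθ))).comp
        (aeval ![Polynomial.X, c]) := by
      ext i
      fin_cases i
      · simp
      · simp only [Fin.mk_one, AlgHom.comp_apply, aeval_X, Matrix.cons_val_one,
          Matrix.cons_val_zero]
        exact Ideal.Quotient.eq.2 (Ideal.mem_span_singleton_self _)
    change π f = 0
    rw [hπ, AlgHom.comp_apply, h, map_zero]

theorem prime_X_one_sub (c : Polynomial ℂ) :
    Prime (X 1 - Polynomial.aeval (X 0) c : Cθ) := by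
  refine ⟨fun h => ?_, fun h => ?_, fun f g h => ?_⟩
  · have h' : (X 1 - Polynomial.aeval (X 0) (c + 1) : Cθ) = -1 := by
      rw [map_add, map_one, ← sub_sub, h, zero_sub]
    have := (X_one_sub_dvd_iff (c + 1) (-1)).1 (h' ▸ dvd_rfl)
    simp at this
  · have := (X_one_sub_dvd_iff c 1).1 h.dvd
    simp at this
  · simpa only [X_one_sub_dvd_iff, map_mul, mul_eq_zero] using h

theorem isRelPrime_X_one_sub {c c' : Polynomial ℂ} (h : c ≠ c') :
    IsRelPrime (X 1 - Polynomial.aeval (X 0) c : Cθ) (X 1 - Polynomial.aeval (X 0) c') := by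
  rw [(prime_X_one_sub c).irreducible.isRelPrime_iff_not_dvd, X_one_sub_dvd_iff]
  have h' : aeval ![Polynomial.X, c] (Polynomial.aeval (X 0 : Cθ) c') = c' := by
    rw [← Polynomial.aeval_algHom_apply]
    simp
  simpa [h', sub_eq_zero] using h

/-- A polynomial vanishing at infinitely many points of the graph of `c` is divisible by the
equation of the graph. -/
theorem X_one_sub_dvd_of_eval_eq_zero (c : Polynomial ℂ) (f : Cθ) (N : ℕ)
    (h : ∀ n : ℕ, N ≤ n → eval ![(n : ℂ), c.eval (n : ℂ)] f = 0) :
    X 1 - Polynomial.aeval (X 0) c ∣ f := by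
  rw [X_one_sub_dvd_iff]
  refine Polynomial.eq_zero_of_infinite_isRoot _
    (((Set.Ici_infinite N).image (Nat.cast_injective (R := ℂ)).injOn).mono ?_)
  rintro _ ⟨n, hn, rfl⟩
  have key : (Polynomial.aeval (n : ℂ)).comp (aeval ![Polynomial.X, c]) =
      aeval ![(n : ℂ), c.eval (n : ℂ)] := by
    ext i
    fin_cases i <;> simp
  have := DFunLike.congr_fun key f
  rw [AlgHom.comp_apply, MvPolynomial.aeval_eq_eval] at this
  replace this := this.trans (h n hn)
  simpa [Polynomial.IsRoot, Polynomial.aeval_def, Polynomial.eval₂_eq_eval_map] using this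

theorem X_one_sub_C_eq (j : ℂ) :
    (X 1 - C j : Cθ) = X 1 - Polynomial.aeval (X 0) (Polynomial.C j) := by
  simp [algebraMap_eq]

theorem facet_sub_C_eq (k : ℂ) :
    (C (3 : ℂ) * X 0 - X 1 - C k : Cθ) =
      -(X 1 - Polynomial.aeval (X 0) (Polynomial.C 3 * Polynomial.X - Polynomial.C k)) := by
  simp only [map_sub, map_mul, Polynomial.aeval_C, Polynomial.aeval_X, algebraMap_eq]
  ring

theorem dfact_dvd_dfact (P : Cθ) {m n : ℤ} (h : m ≤ n) : dfact P m ∣ dfact P n :=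
  Finset.prod_dvd_prod_of_subset _ _ _ (Finset.range_subset_range.2 (by omega))

theorem eval_dfact_eq_zero {P : Cθ} {x : Fin 2 → ℂ} {k m : ℤ} (h : eval x P = k)
    (h0 : 0 ≤ k) (hk : k ≤ m) : eval x (dfact P m) = 0 := by
  lift k to ℕ using h0
  rw [dfact, map_prod]
  refine Finset.prod_eq_zero (i := k) (Finset.mem_range.2 (by omega)) ?_
  simp [h]

theorem dfact_mul_dfact_dvd {e : ℤ × ℤ} {f : Cθ} (hf : f ∈ vanishingIdeal (Omega 3 e)) :
    dfact (X 1) (-e.2 - 1) * dfact (C (3 : ℂ) * X 0 - X 1) (-(3 * e.1) + e.2 - 1) ∣ f := by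
  simp only [dfact, X_one_sub_C_eq, facet_sub_C_eq]
  refine IsRelPrime.mul_dvd ?_ ?_ ?_
  · refine IsRelPrime.prod_left fun j _ => IsRelPrime.prod_right fun k _ => ?_
    rw [IsRelPrime.neg_right_iff]
    refine isRelPrime_X_one_sub fun h => ?_
    simpa using congrArg (Polynomial.coeff · 1) h
  · refine Finset.prod_dvd_of_isRelPrime (fun j _ k _ hjk => ?_) fun j hj => ?_
    · exact isRelPrime_X_one_sub (by simpa using hjk)
    · rw [Finset.mem_range] at hj
      refine X_one_sub_dvd_of_eval_eq_zero _ _ j fun n hn => ?_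
      have := hf ((n : ℤ), (j : ℤ)) ⟨⟨by simp, by simp; omega⟩, fun h => by
        have := h.1
        simp at this
        omega⟩
      simpa using this
  · refine Finset.prod_dvd_of_isRelPrime (fun j _ k _ hjk => ?_) fun k hk => ?_
    · rw [Function.onFun, IsRelPrime.neg_left_iff, IsRelPrime.neg_right_iff]
      exact isRelPrime_X_one_sub (by simpa using hjk)
    · rw [Finset.mem_range] at hk
      rw [neg_dvd]
      refine X_one_sub_dvd_of_eval_eq_zero _ _ k fun n hn => ?_
      have := hf ((n : ℤ), (3 * n - k : ℤ)) ⟨⟨by simp; omega, by simp⟩, fun h => by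
        have := h.2
        simp at this
        omega⟩
      simpa using this

/-- The vanishing ideal of `Ω(e)` is principal, generated by a product of two descending
factorials. -/
theorem vanishingIdeal_Omega (e : ℤ × ℤ) :
    vanishingIdeal (Omega 3 e) = Ideal.span {dfact (X 1) (-e.2 - 1) *
      dfact (C (3 : ℂ) * X 0 - X 1) (-(3 * e.1) + e.2 - 1)} := by
  refine le_antisymm (fun f hf => Ideal.mem_span_singleton.2 (dfact_mul_dfact_dvd hf)) ?_
  rw [Ideal.span_singleton_le_iff_mem]
  rintro ⟨x, y⟩ ⟨⟨hy, hxy⟩, hnot⟩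
  simp only [Sset, Set.mem_ofPred_eq, Prod.snd_add, Prod.fst_add, not_and_or, not_le] at hy hxy hnot
  rw [map_mul, mul_eq_zero]
  rcases hnot with h | h
  · exact Or.inl (eval_dfact_eq_zero (k := y) (by simp) hy (by omega))
  · exact Or.inr (eval_dfact_eq_zero (k := 3 * x - y) (by simp) (by omega) (by omega))

/-- For the rational normal curve of degree `3` and any multidegree `d` with `d₂ ≤ 0` and
`3d₁ − d₂ ≤ 0`, the sum `Σ_{m ∈ JMon₃} I(Ω(d − m))` equals the ideal generated by the two
polynomials `(H₁, −d₂)!·(H₂, −3d₁+d₂+1)!` and `(H₁, −d₂+1)!·(H₂, −3d₁+d₂)!`, where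
`H₁ = θ₂` and `H₂ = 3θ₁ − θ₂`. -/
theorem statement7 (d : ℤ × ℤ) (h1 : d.2 ≤ 0) (h2 : 3 * d.1 - d.2 ≤ 0) :
    (⨆ m ∈ JMon 3, vanishingIdeal (Omega 3 (d - m))) =
      Ideal.span
        {dfact (X 1) (-d.2) *
            dfact (C (3 : ℂ) * X 0 - X 1) (-(3 * d.1) + d.2 + 1),
          dfact (X 1) (-d.2 + 1) *
            dfact (C (3 : ℂ) * X 0 - X 1) (-(3 * d.1) + d.2)} := by
  apply le_antisymm
  · refine iSup₂_le fun m hm => ?_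
    obtain ⟨-, hm1, hm2⟩ := hm
    rw [vanishingIdeal_Omega, Ideal.span_singleton_le_iff_mem, Prod.fst_sub, Prod.snd_sub]
    rcases (by omega : m.2 = 1 ∧ 2 ≤ 3 * m.1 - m.2 ∨ 2 ≤ m.2) with h | h
    · exact Ideal.mem_of_dvd _ (mul_dvd_mul (dfact_dvd_dfact _ (by omega))
        (dfact_dvd_dfact _ (by omega))) (Ideal.subset_span (Set.mem_insert _ _))
    · exact Ideal.mem_of_dvd _ (mul_dvd_mul (dfact_dvd_dfact _ (by omega))
        (dfact_dvd_dfact _ (by omega))) (Ideal.subset_span (Set.mem_insert_of_mem _ rfl))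
  · rw [Ideal.span_insert]
    refine sup_le ?_ ?_
    · refine le_iSup₂_of_le ((1, 1) : ℤ × ℤ) (by simp [JMon, Sset]) ?_
      rw [vanishingIdeal_Omega, Prod.fst_sub, Prod.snd_sub]
      apply le_of_eq
      congr! 4 <;> ring
    · refine le_iSup₂_of_le ((1, 2) : ℤ × ℤ) (by simp [JMon, Sset]) ?_
      rw [vanishingIdeal_Omega, Prod.fst_sub, Prod.snd_sub]
      apply le_of_eq
      congr! 4 <;> ring

end
end

section
/- Let S̃ = ℕ² \ {(1,0)} ⊆ ℤ². For every d = (d₁,d₂) ∈ ℤ², the vanishing ideal in ℂ[θ₁,θ₂] of Ω̃(d) = {a ∈ S̃ : a + d ∉ S̃} is: (i) the principal ideal generated by (∏_{i=0}^{−d₁−1}(θ₁ − i)) · (∏_{j=0}^{−d₂−1}(θ₂ − j)) if (1,0) − d ∉ S̃; and (ii) the ideal generated by the two polynomials (∏_{i=0}^{−d₁−1}(θ₁ − i)) · (∏_{j=0}^{−d₂−1}(θ₂ − j)) · (θ₁ + d₁ − 1) and (∏_{i=0}^{−d₁−1}(θ₁ − i)) · (∏_{j=0}^{−d₂−1}(θ₂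 − j)) · (θ₂ + d₂) if (1,0) − d ∈ S̃; here an empty product (upper index negative) is 1. (This computes the multigraded pieces of the ring of differential operators of the non-scored semigroup ring ℂ[st, s², s³, t].) -/
open MvPolynomial

noncomputable section

/-- `S̃ = ℕ² \ {(1, 0)}`, the exponent set of the non-normal, non-scored affine semigroup
ring `R_Ã = ℂ[st, s², s³, t]`. -/
def Stilde : Set (ℤ × ℤ) := {a | 0 ≤ a.1 ∧ 0 ≤ a.2 ∧ a ≠ (1, 0)}

/-- `Ω̃(d) = {a ∈ S̃ : a + d ∉ S̃}`. -/
def Omegat (d : ℤ × ℤ) : Set (ℤ × ℤ) := {a | a ∈ Stilde ∧ a + d ∉ Stilde}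

theorem sub_aeval_mem {σ R : Type*} [CommRing R] (I : Ideal (MvPolynomial σ R))
    (φ : σ → MvPolynomial σ R) (h : ∀ i, X i - φ i ∈ I) (f : MvPolynomial σ R) :
    f - aeval φ f ∈ I := by
  have key : Ideal.Quotient.mkₐ R I = (Ideal.Quotient.mkₐ R I).comp (aeval φ) := by
    ext i
    simpa using Ideal.Quotient.eq.mpr (h i)
  exact Ideal.Quotient.eq.mp (DFunLike.congr_fun key f)

theorem X_sub_C_dvd_of_eval_eq_zero {σ R : Type*} [DecidableEq σ] [CommRing R] [IsDomain R]
    {T : Set R} (hT : T.Infinite) (k : σ) (c : R) (f : MvPolynomial σ R)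
    (h : ∀ v : σ → R, v k = c → (∀ i ≠ k, v i ∈ T) → eval v f = 0) :
    X k - C c ∣ f := by
  have hzero : aeval (Function.update X k (C c)) f = (0 : MvPolynomial σ R) := by
    refine funext_set (fun _ => T) (fun _ => hT) fun v hv => ?_
    have heval : eval v (aeval (Function.update X k (C c)) f) =
        eval (Function.update v k c) f := by
      rw [← coe_aeval_eq_eval, ← coe_aeval_eq_eval, RingHom.coe_coe, RingHom.coe_coe,
        ← AlgHom.comp_apply, comp_aeval]
      congr 2
      funext i
      by_cases hi : i = k
      · subst hi; simp
      · simp [hi]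
    rw [heval, map_zero]
    refine h _ (by simp) fun i hi => ?_
    simpa [hi] using hv i trivial
  have hmem := sub_aeval_mem (Ideal.span {X k - C c}) (Function.update X k (C c))
    (fun i => by
      by_cases hi : i = k
      · subst hi; simp
      · simp [hi]) f
  rwa [hzero, sub_zero, Ideal.mem_span_singleton] at hmem

theorem prod_X_sub_C_dvd_of_eval_eq_zero {σ R : Type*} [DecidableEq σ] [CommRing R] [IsDomain R]
    [CharZero R] {T : Set R} (hT : T.Infinite) (k : σ) (n : ℕ) (f : MvPolynomial σ R)
    (h : ∀ j < n, ∀ v : σ → R, v k = j → (∀ i ≠ k, v i ∈ T) → eval v f = 0) :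
    ∏ j ∈ Finset.range n, (X k - C (j : R)) ∣ f := by
  induction n with
  | zero => simp
  | succ n ih =>
    obtain ⟨g, rfl⟩ := ih fun j hj => h j (by omega)
    rw [Finset.prod_range_succ]
    refine mul_dvd_mul_left _ (X_sub_C_dvd_of_eval_eq_zero hT k _ g fun v hv hvT => ?_)
    have hprod := h n (by omega) v hv hvT
    rw [map_mul, map_prod] at hprod
    refine (mul_eq_zero.mp hprod).resolve_left (Finset.prod_ne_zero_iff.mpr fun j hj => ?_)
    have hne : n ≠ j := (Finset.mem_range.mp hj).ne'
    simpa [hv, sub_eq_zero] using hne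

theorem mem_span_X_sub_C_pair {R : Type*} [CommRing R] (a b : R) (f : MvPolynomial (Fin 2) R)
    (h : eval ![a, b] f = 0) : f ∈ Ideal.span {X 0 - C a, X 1 - C b} := by
  have hmem := sub_aeval_mem (Ideal.span {X 0 - C a, X 1 - C b}) (fun i => C (![a, b] i))
    (fun i => by fin_cases i <;> exact Ideal.subset_span (by simp)) f
  have hconst : aeval (fun i => C (![a, b] i)) f =
      (C (eval ![a, b] f) : MvPolynomial (Fin 2) R) := by
    rw [← coe_aeval_eq_eval, RingHom.coe_coe, ← algebraMap_eq]
    exact aeval_algebraMap_apply _ _ _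
  rwa [hconst, h, map_zero, sub_zero] at hmem

theorem infinite_natCast_ge (N : ℕ) : {z : ℂ | ∃ t : ℕ, N ≤ t ∧ (t : ℂ) = z}.Infinite :=
  (Set.Ici_infinite N).image Nat.cast_injective.injOn

theorem eval_dfact_eq_zero_iff_s18 (v : Fin 2 → ℂ) (k : Fin 2) (x p : ℤ) (hx : v k = x) :
    eval v (dfact (X k) (p - 1)) = 0 ↔ 0 ≤ x ∧ x < p := by
  rw [dfact, map_prod, Finset.prod_eq_zero_iff]
  simp only [Finset.mem_range, map_sub, eval_X, eval_C, hx, sub_eq_zero]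
  constructor
  · rintro ⟨j, hj, hxj⟩
    have : x = j := by exact_mod_cast hxj
    omega
  · rintro ⟨h0, hp⟩
    lift x to ℕ using h0
    exact ⟨x, by omega, by simp⟩

theorem eval_dfact_mul_dfact_eq_zero_iff (a d : ℤ × ℤ) (ha : 0 ≤ a.1 ∧ 0 ≤ a.2) :
    eval ![(a.1 : ℂ), (a.2 : ℂ)] (dfact (X 0) (-d.1 - 1) * dfact (X 1) (-d.2 - 1)) = 0 ↔
      ¬ (0 ≤ a.1 + d.1 ∧ 0 ≤ a.2 + d.2) := by
  rw [map_mul, mul_eq_zero, eval_dfact_eq_zero_iff_s18 _ 0 a.1 _ (by simp),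
    eval_dfact_eq_zero_iff_s18 _ 1 a.2 _ (by simp)]
  omega

theorem mem_Omegat_iff (a d : ℤ × ℤ) :
    a ∈ Omegat d ↔ a ∈ Stilde ∧ (¬ (0 ≤ a.1 + d.1 ∧ 0 ≤ a.2 + d.2) ∨ a = (1, 0) - d) := by
  simp only [Omegat, Stilde, Set.mem_ofPred_eq, eq_sub_iff_add_eq, Prod.fst_add, Prod.snd_add]
  tauto

theorem dvd_of_mem_vanishingIdeal (d : ℤ × ℤ) (f : Cθ) (hf : f ∈ vanishingIdeal (Omegat d)) :
    dfact (X 0) (-d.1 - 1) * dfact (X 1) (-d.2 - 1) ∣ f := by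
  have hvan : ∀ v : Fin 2 → ℂ, ∀ x y : ℕ, v 0 = x → v 1 = y → (x, y) ≠ (1, 0) →
      ((x : ℤ) < -d.1 ∨ (y : ℤ) < -d.2) → eval v f = 0 := by
    intro v x y hx hy hxy hlt
    have hv : v = ![((x : ℤ) : ℂ), ((y : ℤ) : ℂ)] := by
      ext i; fin_cases i <;> simp [hx, hy]
    rw [hv]
    refine hf ((x : ℤ), (y : ℤ)) ((mem_Omegat_iff _ _).mpr ⟨⟨?_, ?_, ?_⟩, Or.inl ?_⟩)
    · simp
    · simp
    · simpa [Prod.ext_iff] using hxy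
    · simp only
      omega
  obtain ⟨g, rfl⟩ : dfact (X 0) (-d.1 - 1) ∣ f := by
    refine prod_X_sub_C_dvd_of_eval_eq_zero (infinite_natCast_ge 1) 0 _ f fun j hj v hv hT => ?_
    obtain ⟨t, ht, hvt⟩ := hT 1 (by decide)
    exact hvan v j t hv hvt.symm (by simp; omega) (by omega)
  refine mul_dvd_mul_left _ (prod_X_sub_C_dvd_of_eval_eq_zero
    (infinite_natCast_ge (2 + (-d.1).toNat)) 1 _ g fun j hj v hv hT => ?_)
  obtain ⟨t, ht, hvt⟩ := hT 0 (by decide)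
  have hprod := hvan v t j hvt.symm hv (by simp; omega) (by omega)
  rw [map_mul] at hprod
  refine (mul_eq_zero.mp hprod).resolve_left fun hzero => ?_
  rw [eval_dfact_eq_zero_iff_s18 v 0 t _ (by simp [hvt])] at hzero
  omega

/-- The multigraded pieces of the ring of differential operators of `ℂ[st, s², s³, t]`:
the vanishing ideal of `Ω̃(d)` is generated by
`(θ₁, −d₁−1)!·(θ₂, −d₂−1)!` when `(1, 0) − d ∉ S̃`, and by the two polynomials
`(θ₁, −d₁−1)!·(θ₂, −d₂−1)!·(θ₁ + d₁ − 1)` and `(θ₁, −d₁−1)!·(θ₂, −d₂−1)!·(θ₂ + d₂)`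
when `(1, 0) − d ∈ S̃` (empty products equal to `1`). -/
theorem statement18 (d : ℤ × ℤ) :
    (((1, 0) : ℤ × ℤ) - d ∉ Stilde →
      vanishingIdeal (Omegat d) =
        Ideal.span {dfact (X 0) (-d.1 - 1) * dfact (X 1) (-d.2 - 1)}) ∧
    (((1, 0) : ℤ × ℤ) - d ∈ Stilde →
      vanishingIdeal (Omegat d) =
        Ideal.span
          {dfact (X 0) (-d.1 - 1) * dfact (X 1) (-d.2 - 1) * (X 0 + C (d.1 : ℂ) - 1),
            dfact (X 0) (-d.1 - 1) * dfact (X 1) (-d.2 - 1) * (X 1 + C (d.2 : ℂ))}) := by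
  set F := dfact (X 0) (-d.1 - 1) * dfact (X 1) (-d.2 - 1)
  constructor
  · intro he
    refine le_antisymm
      (fun f hf => Ideal.mem_span_singleton.mpr (dvd_of_mem_vanishingIdeal d f hf)) ?_
    rw [Ideal.span_singleton_le_iff_mem]
    intro a ha
    obtain ⟨haS, hlt | rfl⟩ := (mem_Omegat_iff a d).mp ha
    · exact (eval_dfact_mul_dfact_eq_zero_iff a d ⟨haS.1, haS.2.1⟩).mpr hlt
    · exact absurd haS he
  · intro he
    have hX0 : (X 0 + C (d.1 : ℂ) - 1 : Cθ) = X 0 - C ((1 - d.1 : ℤ) : ℂ) := by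
      simp only [Int.cast_sub, Int.cast_one, map_sub, map_one]
      ring
    have hX1 : (X 1 + C (d.2 : ℂ) : Cθ) = X 1 - C ((0 - d.2 : ℤ) : ℂ) := by
      simp only [Int.cast_sub, Int.cast_zero, map_sub, map_zero]
      ring
    rw [hX0, hX1]
    refine le_antisymm (fun f hf => ?_) (Ideal.span_le.mpr ?_)
    · obtain ⟨g, rfl⟩ := dvd_of_mem_vanishingIdeal d f hf
      have hprod := hf ((1, 0) - d) ((mem_Omegat_iff _ _).mpr ⟨he, Or.inr rfl⟩)
      rw [map_mul] at hprod
      have hg := (mul_eq_zero.mp hprod).resolve_left fun hzero => by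
        have hlt := (eval_dfact_mul_dfact_eq_zero_iff _ d ⟨he.1, he.2.1⟩).mp hzero
        simp at hlt
      obtain ⟨u, w, huw⟩ := Ideal.mem_span_pair.mp (mem_span_X_sub_C_pair _ _ g hg)
      refine Ideal.mem_span_pair.mpr ⟨u, w, ?_⟩
      rw [← huw, Prod.fst_sub, Prod.snd_sub]
      ring
    · have hvan : ∀ a ∈ Omegat d, eval ![(a.1 : ℂ), (a.2 : ℂ)] F = 0 ∨ a = (1, 0) - d :=
        fun a ha => by
          obtain ⟨haS, hlt⟩ := (mem_Omegat_iff a d).mp ha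
          exact hlt.imp_left (eval_dfact_mul_dfact_eq_zero_iff a d ⟨haS.1, haS.2.1⟩).mpr
      rintro f (rfl | rfl) a ha <;> obtain hzero | rfl := hvan a ha <;> rw [map_mul] <;>
        first | rw [hzero, zero_mul] | simp

end
end
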